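/- There is no pair of real numbers (γ, a) with a ∈ (−2, −1/2) and a ≠ −1 such that both (2−7a)γ² + 18a³ + 44a² + 10a − 4 < 0 and (2a−7)γ² − 4a³ + 10a² + 44a + 18 > 0 hold. -/

import Mathlib

theorem incompatible_inequalities :
    ¬ ∃ γ a : ℝ, a ∈ Set.Ioo (-2 : ℝ) (-(1/2) : ℝ) ∧ a ≠ -1 ∧
      (2 - 7*a)*γ^2 + 18*a^3 + 44*a^2 + 10*a - 4 < 0 ∧
      (2*a - 7)*γ^2 - 4*a^3 + 10*a^2 + 44*a + 18 > 0 := by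
  rintro ⟨γ, a, ⟨ha₁, ha₂⟩, -, h₁, h₂⟩
  rcases le_total a (-(3/5)) with h | h
  · have hγ : 0 ≤ (2 - 7*a)*γ^2 := mul_nonneg (by linarith) (sq_nonneg γ)
    have hP : 0 < 18*a^3 + 44*a^2 + 10*a - 4 := by
      nlinarith [mul_nonneg (sub_nonneg.2 h) (sub_nonneg.2 ha₁.le),
        mul_nonneg (sub_nonneg.2 h) (sq_nonneg (a + 2)),
        mul_nonneg (sub_nonneg.2 h) (sq_nonneg (a + 3/2)),
        mul_nonneg (sub_nonneg.2 ha₁.le) (sq_nonneg (a + 3/5))]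
    linarith
  · have hγ : 0 ≤ (7 - 2*a)*γ^2 := mul_nonneg (by linarith) (sq_nonneg γ)
    have hQ : -4*a^3 + 10*a^2 + 44*a + 18 < 0 := by
      nlinarith [mul_nonneg (sub_nonneg.2 h) (sub_nonneg.2 ha₂.le),
        mul_nonneg (mul_nonneg (sub_nonneg.2 h) (sub_nonneg.2 ha₂.le)) (by linarith : 0 ≤ -a)]
    linarith
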